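/- arXiv:math/0511313 — 2 statements merged into one kernel-verified Lean document; each statement's English description precedes it below -/
import Mathlib

section
/- Let A be an algebra with a term t Mal'cev modulo F and G. Then for every reflexive admissible relation R on A: Cg(R) ⊆ (F(R) + F(R⁻)) ∘ R ∘ (G(R) + G(R⁻)), where Cg(R) is the smallest congruence of A containing R, R⁻ is the converse of R, and + is the join of relations. -/
structure Signature where
  symbols : Type
  arity : symbols → ℕ

structure UAAlgebra (σ : Signature) where
  carrier : Type
  ops : ∀ s, (Fin (σ.arity s) → carrier) → carrier

namespace Paper

variable {σ : Signature}

/-- Binary relations on the carrier of an algebra. -/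
abbrev Rel (A : UAAlgebra σ) := A.carrier → A.carrier → Prop

/-- A relation is admissible (compatible) if it is preserved by all operations,
i.e. it is a subalgebra of `A × A`. -/
def Compatible (A : UAAlgebra σ) (R : Rel A) : Prop :=
  ∀ s (f g : Fin (σ.arity s) → A.carrier),
    (∀ j, R (f j) (g j)) → R (A.ops s f) (A.ops s g)

/-- Reflexive and admissible. -/
def RAdm (A : UAAlgebra σ) (R : Rel A) : Prop :=
  Reflexive R ∧ Compatible A R

/-- Relational composition. -/
def comp {A : UAAlgebra σ} (R S : Rel A) : Rel A :=
  fun a c => ∃ b, R a b ∧ S b c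

/-- `cl A X` : the least compatible relation containing `X`. -/
def cl (A : UAAlgebra σ) (X : Rel A) : Rel A :=
  fun a b => ∀ S : Rel A, Compatible A S → (∀ x y, X x y → S x y) → S a b

/-- The least reflexive compatible relation containing `X`. -/
def clRefl (A : UAAlgebra σ) (X : Rel A) : Rel A :=
  fun a b => ∀ S : Rel A, Reflexive S → Compatible A S → (∀ x y, X x y → S x y) → S a b

/-- `altComp R S n` is `R ∘ₙ S`, the alternating composition
`R ∘ S ∘ R ∘ ⋯` with `n` factors (`n - 1` occurrences of `∘`);
by convention `R ∘₀ S` is the identity relation. -/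
def altComp {A : UAAlgebra σ} (R S : Rel A) : ℕ → Rel A
  | 0 => Eq
  | n + 1 => comp R (altComp S R n)

/-- `relPow R n = Rⁿ`, with `R⁰` the identity relation. -/
def relPow {A : UAAlgebra σ} (R : Rel A) : ℕ → Rel A
  | 0 => Eq
  | n + 1 => comp R (relPow R n)

/-- The join `R + S = ⋃ₙ R ∘ₙ S`. -/
def join {A : UAAlgebra σ} (R S : Rel A) : Rel A :=
  fun a b => ∃ n, altComp R S n a b

/-- Converse relation `R⁻`. -/
def conv {A : UAAlgebra σ} (R : Rel A) : Rel A :=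
  fun a b => R b a

/-- Composition of a finite list of relations (empty list gives the identity). -/
def compList {A : UAAlgebra σ} : List (Rel A) → Rel A
  | [] => Eq
  | r :: l => comp r (compList l)

/-- Join of a family of relations: the union of all finite compositions of members. -/
def joinFam {A : UAAlgebra σ} {ι : Type} (R : ι → Rel A) : Rel A :=
  fun a b => ∃ l : List ι, compList (l.map R) a b

/-- The smallest congruence containing `X`. -/
def cg (A : UAAlgebra σ) (X : Rel A) : Rel A :=
  fun a b => ∀ S : Rel A, Equivalence S → Compatible A S →
    (∀ x y, X x y → S x y) → S a b

/-- Terms of the signature `σ` in `n` variables. -/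
inductive Term (σ : Signature) (n : ℕ) : Type
  | var : Fin n → Term σ n
  | op : ∀ s, (Fin (σ.arity s) → Term σ n) → Term σ n

/-- Evaluation of a term in an algebra under an environment. -/
def Term.eval {n : ℕ} (A : UAAlgebra σ) (env : Fin n → A.carrier) : Term σ n → A.carrier
  | .var k => env k
  | .op s args => A.ops s fun j => (args j).eval A env

/-- The ternary term operation induced by a ternary term. -/
def tApp (A : UAAlgebra σ) (t : Term σ 3) (a b c : A.carrier) : A.carrier :=
  t.eval A ![a, b, c]

/-- `t` is Mal'cev modulo `F` and `G`: whenever `a R b` with `R` reflexive admissible,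
`a F(R) t(a,b,b)` and `t(a,a,b) G(R) b`. -/
def MalcevMod (A : UAAlgebra σ) (F G : Rel A → Rel A) (t : Term σ 3) : Prop :=
  ∀ R : Rel A, RAdm A R → ∀ a b : A.carrier, R a b →
    F R a (tApp A t a b b) ∧ G R (tApp A t a a b) b

end Paper

open Paper

namespace Paper

open Relation

variable {σ : Signature} {A : UAAlgebra σ}

theorem RAdm.conv {R : Rel A} (hR : RAdm A R) : RAdm A (conv R) :=
  ⟨fun a => hR.1 a, fun s f g h => hR.2 s g f h⟩

/-- The transitive closure of a union of two reflexive admissible relations is admissible. -/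
theorem compatible_reflTransGen {R S : Rel A} (hR : RAdm A R) (hS : RAdm A S) :
    Compatible A (ReflTransGen (R ⊔ S)) := by
  intro s f g hfg
  have update_rel {W : Rel A} (hW : RAdm A W) (h : Fin (σ.arity s) → A.carrier)
      (j : Fin (σ.arity s)) {x y : A.carrier} (hxy : W x y) :
      W (A.ops s (Function.update h j x)) (A.ops s (Function.update h j y)) := by
    refine hW.2 s _ _ fun k => ?_
    by_cases hk : k = j
    · subst hk
      simpa using hxy
    · simpa [hk] using hW.1 (h k)
  suffices H : ∀ u : Finset (Fin (σ.arity s)),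
      ReflTransGen (R ⊔ S) (A.ops s f) (A.ops s (u.piecewise g f)) by
    simpa using H Finset.univ
  intro u
  induction u using Finset.induction_on with
  | empty => simpa using ReflTransGen.refl
  | insert j u hj ih =>
    refine ih.trans ?_
    have h := ReflTransGen.lift (p := R ⊔ S)
      (fun x => A.ops s (Function.update (u.piecewise g f) j x))
      (fun x y hxy => hxy.imp (update_rel hR _ j) (update_rel hS _ j)) _ _ (hfg j)
    have hfj : Function.update (u.piecewise g f) j (f j) = u.piecewise g f := by
      rw [← Finset.piecewise_eq_of_notMem u g f hj, Function.update_eq_self]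
    rw [Finset.piecewise_insert]
    simpa only [Function.onFun, hfj] using h

theorem join_of_reflTransGen {R S : Rel A} (hR : ∀ x, R x x) (hS : ∀ x, S x x)
    {a b : A.carrier} (h : ReflTransGen (R ⊔ S) a b) : join R S a b := by
  induction h using ReflTransGen.head_induction_on with
  | refl => exact ⟨0, rfl⟩
  | @head a c hac _ ih =>
    obtain ⟨n, hn⟩ := ih
    rcases hac with hac | hac
    · exact ⟨n + 2, c, hac, c, hS c, hn⟩
    · exact ⟨n + 2, a, hR a, c, hac, hn⟩

theorem Term.eval_rel {W : Rel A} (hW : Compatible A W) {n : ℕ} (t : Term σ n)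
    {e e' : Fin n → A.carrier} (he : ∀ i, W (e i) (e' i)) : W (t.eval A e) (t.eval A e') := by
  induction t with
  | var k => exact he k
  | op s args ih => exact hW s _ _ ih

theorem tApp_rel {W : Rel A} (hW : Compatible A W) (t : Term σ 3) {a b c a' b' c' : A.carrier}
    (ha : W a a') (hb : W b b') (hc : W c c') : W (tApp A t a b c) (tApp A t a' b' c') := by
  refine t.eval_rel hW fun i => ?_
  fin_cases i <;> assumption

theorem relPow_succ_last {U : Rel A} {n : ℕ} {a c : A.carrier} (h : relPow U (n + 1) a c) :
    ∃ d, relPow U n a d ∧ U d c := by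
  induction n generalizing a with
  | zero =>
    obtain ⟨b, hab, rfl⟩ := h
    exact ⟨a, rfl, hab⟩
  | succ n ih =>
    obtain ⟨b, hab, hbc⟩ := h
    obtain ⟨d, hbd, hdc⟩ := ih hbc
    exact ⟨d, ⟨b, hab, hbd⟩, hdc⟩

theorem exists_relPow_of_reflTransGen {U : Rel A} {a c : A.carrier} (h : ReflTransGen U a c) :
    ∃ n, relPow U n a c := by
  induction h using ReflTransGen.head_induction_on with
  | refl => exact ⟨0, rfl⟩
  | @head a b hab _ ih =>
    obtain ⟨n, hn⟩ := ih
    exact ⟨n + 1, b, hab, hn⟩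

/-- A congruence generated by a reflexive admissible relation consists of zigzags. -/
theorem reflTransGen_of_cg {R : Rel A} (hR : RAdm A R) {a c : A.carrier} (h : cg A R a c) :
    ReflTransGen (R ⊔ conv R) a c := by
  refine h _ ⟨fun _ => .refl, fun {_ _} hxy => ?_, fun {_ _ _} => .trans⟩
    (compatible_reflTransGen hR hR.conv) fun x y hxy => .single (.inl hxy)
  have : Std.Symm (R ⊔ conv R) := ⟨fun _ _ h => h.symm⟩
  exact symm_of (ReflTransGen (R ⊔ conv R)) hxy

/-- If `a` is related to `tApp A t a b b` by `P` and `tApp A t a a b` to `b` by `Q` along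
every step of a zigzag of `R`, then the whole zigzag lies in `P ∘ R ∘ Q`. -/
theorem comp_of_relPow {P R Q : Rel A} (hP : Compatible A P) (hP' : IsPreorder A.carrier P)
    (hQ : Compatible A Q) (hQ' : IsPreorder A.carrier Q) (hR : RAdm A R) (t : Term σ 3)
    (ht : ∀ a b, (R ⊔ conv R) a b → P a (tApp A t a b b) ∧ Q (tApp A t a a b) b)
    (n : ℕ) {a c : A.carrier} (h : relPow (R ⊔ conv R) n a c) : comp P (comp R Q) a c := by
  induction n using Nat.strong_induction_on generalizing a c with
  | _ n ih =>
    match n, h with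
    | 0, h =>
      obtain rfl : a = c := h
      exact ⟨a, refl_of P a, a, hR.1 a, refl_of Q a⟩
    | 1, ⟨b, hab, hbc⟩ =>
      obtain rfl : b = c := hbc
      rcases hab with hab | hab
      · exact ⟨a, refl_of P a, b, hab, refl_of Q b⟩
      · exact ⟨_, (ht a b (.inr hab)).1, _, tApp_rel hR.2 t (hR.1 a) hab (hR.1 b),
          (ht a b (.inr hab)).2⟩
    | n + 2, ⟨b, hab, hbc⟩ =>
      obtain ⟨d, hbd, hdc⟩ := relPow_succ_last hbc
      obtain ⟨a₁, ha₁, d₁, had, hd₁⟩ := ih (n + 1) (by omega) (a := a) (c := d) ⟨b, hab, hbd⟩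
      obtain ⟨b₁, hb₁, d₂, hbd', hd₂⟩ := ih n (by omega) hbd
      obtain ⟨b₂, hb₂, c₁, hbc', hc₁⟩ := ih (n + 1) (by omega) hbc
      exact ⟨_, trans_of P (ht a b hab).1 (tApp_rel hP t ha₁ hb₁ hb₂), _,
        tApp_rel hR.2 t had hbd' hbc', trans_of Q (tApp_rel hQ t hd₁ hd₂ hc₁) (ht d c hdc).2⟩

end Paper

/-- Theorem 1(xi): `Cg(R) ⊆ (F(R)+F(R⁻)) ∘ R ∘ (G(R)+G(R⁻))`. -/
theorem stmt10 {σ : Signature} (A : UAAlgebra σ) (F G : Rel A → Rel A)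
    (hF : ∀ R, RAdm A R → RAdm A (F R)) (hG : ∀ R, RAdm A R → RAdm A (G R))
    (t : Term σ 3) (ht : MalcevMod A F G t)
    (R : Rel A) (hR : RAdm A R) :
    ∀ a c, cg A R a c →
      comp (join (F R) (F (conv R))) (comp R (join (G R) (G (conv R)))) a c := by
  intro a c hac
  obtain ⟨n, hn⟩ := exists_relPow_of_reflTransGen (reflTransGen_of_cg hR hac)
  have hFR := hF R hR
  have hFR' := hF _ hR.conv
  have hGR := hG R hR
  have hGR' := hG _ hR.conv
  obtain ⟨x, hax, y, hxy, hyc⟩ := comp_of_relPow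
    (compatible_reflTransGen hFR hFR') { refl := fun _ => .refl, trans := fun _ _ _ => .trans }
    (compatible_reflTransGen hGR hGR') { refl := fun _ => .refl, trans := fun _ _ _ => .trans }
    hR t (fun u v huv => huv.elim
      (fun h => (ht R hR u v h).imp (fun h => .single (.inl h)) fun h => .single (.inl h))
      (fun h => (ht _ hR.conv u v h).imp (fun h => .single (.inr h)) fun h => .single (.inr h)))
    n hn
  exact ⟨x, join_of_reflTransGen hFR.1 hFR'.1 hax, y, hxy,
    join_of_reflTransGen hGR.1 hGR'.1 hyc⟩
end

section
/- Let A be an algebra and F, G maps from reflexive admissible relations on A to reflexive admissible relations on A. If A has a term Mal'cev modulo F and G, then A has a term Mal'cev modulo F' and G', where F'(R) = F(F(R)) ∘ F(F(R)) ∘ F(F(R)) and G'(R) = G(G(R)) ∘ G(G(R)) ∘ G(G(R)). -/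
open Paper

namespace Paper

variable {σ : Signature}

/-- Substitution of terms for the variables of a term. -/
def Term.subst {m n : ℕ} (u : Fin m → Term σ n) : Term σ m → Term σ n
  | .var k => u k
  | .op s args => .op s fun j => (args j).subst u

theorem Term.eval_subst {m n : ℕ} (A : UAAlgebra σ) (env : Fin n → A.carrier)
    (u : Fin m → Term σ n) (t : Term σ m) :
    (t.subst u).eval A env = t.eval A fun k => (u k).eval A env := by
  induction t with
  | var k => rfl
  | op s args ih => simp only [Term.subst, Term.eval, ih]

theorem Term.eval_subst_three {n : ℕ} (A : UAAlgebra σ) (env : Fin n → A.carrier)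
    (t : Term σ 3) (u v w : Term σ n) :
    (t.subst ![u, v, w]).eval A env
      = tApp A t (u.eval A env) (v.eval A env) (w.eval A env) := by
  rw [Term.eval_subst, tApp]
  congr 1
  funext k
  fin_cases k <;> rfl

theorem Compatible.eval {A : UAAlgebra σ} {R : Rel A} (hR : Compatible A R) {n : ℕ}
    {f g : Fin n → A.carrier} (hfg : ∀ k, R (f k) (g k)) (t : Term σ n) :
    R (t.eval A f) (t.eval A g) := by
  induction t with
  | var k => exact hfg k
  | op s args ih => exact hR s _ _ ih

theorem Compatible.tApp {A : UAAlgebra σ} {R : Rel A} (hR : Compatible A R) (t : Term σ 3)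
    {a b c a' b' c' : A.carrier} (ha : R a a') (hb : R b b') (hc : R c c') :
    R (tApp A t a b c) (tApp A t a' b' c') := by
  refine hR.eval (fun k => ?_) t
  fin_cases k
  exacts [ha, hb, hc]

/-- The term witnessing that a Mal'cev term modulo `F` and `G` can be improved to one modulo
threefold compositions of `F ∘ F` and `G ∘ G`. -/
def Term.improve (t : Term σ 3) : Term σ 3 :=
  let x : Term σ 3 := .var 0
  let y : Term σ 3 := .var 1
  let z : Term σ 3 := .var 2
  let m (u v w : Term σ 3) : Term σ 3 := t.subst ![u, v, w]
  m (m (m x (m x y y) (m x y z)) (m x (m y y y) (m y y z)) (m x y z))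
    (m x y z)
    (m (m x y z) (m (m x y y) (m y y y) z) (m (m x y z) (m y y z) z))

theorem tApp_improve (A : UAAlgebra σ) (t : Term σ 3) (x y z : A.carrier) :
    tApp A t.improve x y z =
      let m := tApp A t
      m (m (m x (m x y y) (m x y z)) (m x (m y y y) (m y y z)) (m x y z))
        (m x y z)
        (m (m x y z) (m (m x y y) (m y y y) z) (m (m x y z) (m y y z) z)) := by
  rw [tApp, Term.improve]
  simp only [Term.eval_subst_three]
  rfl

end Paper

/-- Theorem 2: if `A` has a term Mal'cev modulo `F` and `G`, then `A` has a term
Mal'cev modulo `F'` and `G'`, where `F'(R) = F(F(R)) ∘ F(F(R)) ∘ F(F(R))` and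
`G'(R) = G(G(R)) ∘ G(G(R)) ∘ G(G(R))`. -/
theorem stmt14 {σ : Signature} (A : UAAlgebra σ) (F G : Rel A → Rel A)
    (hF : ∀ R, RAdm A R → RAdm A (F R)) (hG : ∀ R, RAdm A R → RAdm A (G R))
    (h : ∃ t : Term σ 3, MalcevMod A F G t) :
    ∃ t' : Term σ 3,
      MalcevMod A
        (fun R => comp (F (F R)) (comp (F (F R)) (F (F R))))
        (fun R => comp (G (G R)) (comp (G (G R)) (G (G R)))) t' := by
  obtain ⟨t, ht⟩ := h
  refine ⟨t.improve, fun R hR a b hab => ?_⟩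
  obtain ⟨hF₁, cF₁⟩ := hF R hR
  obtain ⟨hG₁, cG₁⟩ := hG R hR
  obtain ⟨hF₂, cF₂⟩ := hF _ (hF R hR)
  obtain ⟨hG₂, cG₂⟩ := hG _ (hG R hR)
  have f₁ {u v} (huv : R u v) := (ht R hR u v huv).1
  have g₁ {u v} (huv : R u v) := (ht R hR u v huv).2
  have f₂ {u v} (huv : F R u v) := (ht _ (hF R hR) u v huv).1
  have g₂ {u v} (huv : G R u v) := (ht _ (hG R hR) u v huv).2
  simp only [tApp_improve]
  constructor
  · have hx := f₂ (f₁ hab)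
    have hy := f₂ (hF₁ b)
    exact ⟨_, hx, _, cF₂.tApp t hx (hF₂ _) (hF₂ _),
      cF₂.tApp t (cF₂.tApp t hx (cF₂.tApp t (hF₂ a) hy hy) (hF₂ _)) (hF₂ _)
        (f₂ (cF₁.tApp t (f₁ hab) (f₁ (hR.1 b)) (hF₁ b)))⟩
  · have hy := g₂ (g₁ hab)
    have hx := g₂ (hG₁ a)
    exact ⟨_, cG₂.tApp t
        (g₂ (cG₁.tApp t (hG₁ a) (g₁ (hR.1 a)) (g₁ hab))) (hG₂ _)
        (cG₂.tApp t (hG₂ _) (cG₂.tApp t hx hx (hG₂ b)) hy),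
      _, cG₂.tApp t (hG₂ _) (hG₂ _) hy, hy⟩
end
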